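/- arXiv:2006.08138 — 4 statements merged into one kernel-verified Lean document; each statement's English description precedes it below -/
import Mathlib

section
/- Let n, k be positive integers with k ≤ n, and let a : {1,...,n} → ℝ be a nondecreasing finite sequence of real numbers (a₁ ≤ a₂ ≤ ... ≤ aₙ). Then sup over λ ∈ ℝ of ( λ − (1/k)·Σ_{i=1}^n max(λ − a_i, 0) ) equals (1/k)·Σ_{i=1}^k a_i, i.e., the inverted CVaR at level α = k/n of the empirical distribution of a₁,...,aₙ equals the average of the k smallest values. -/
open Finset

/-- The inverted CVaR at level `α = k/n` of the empirical distribution of a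
nondecreasing sequence `a₁ ≤ ⋯ ≤ aₙ` equals the average of the `k` smallest values. -/
theorem inverted_cvar_eq_avg_bottom_k (n k : ℕ) (hn : 0 < n) (hk : 0 < k) (hkn : k ≤ n)
    (a : Fin n → ℝ) (ha : Monotone a) :
    (⨆ lam : ℝ, (lam - (k : ℝ)⁻¹ * ∑ i : Fin n, max (lam - a i) 0)) =
      (k : ℝ)⁻¹ * ∑ i : Fin k, a (Fin.castLE hkn i) := by
  obtain ⟨m, rfl⟩ := Nat.exists_eq_add_of_le hkn
  have hk' : (0 : ℝ) < k := Nat.cast_pos.mpr hk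
  have sum_bottom (lam : ℝ) : ∑ i : Fin k, (lam - a (Fin.castLE hkn i)) =
      k * lam - ∑ i : Fin k, a (Fin.castLE hkn i) := by
    simp [Finset.sum_sub_distrib]
  have objective_eq (lam : ℝ) : lam - (k : ℝ)⁻¹ *
      ∑ i : Fin k, (lam - a (Fin.castLE hkn i)) =
      (k : ℝ)⁻¹ * ∑ i : Fin k, a (Fin.castLE hkn i) := by
    rw [sum_bottom]
    field_simp
    ring
  have upper (lam : ℝ) : lam - (k : ℝ)⁻¹ * ∑ i, max (lam - a i) 0 ≤
      (k : ℝ)⁻¹ * ∑ i : Fin k, a (Fin.castLE hkn i) := by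
    rw [← objective_eq lam]
    gcongr
    rw [Fin.sum_univ_add]
    exact (Finset.sum_le_sum fun i _ => le_max_left _ _).trans
      (le_add_of_nonneg_right (Finset.sum_nonneg fun i _ => le_max_right _ _))
  refine le_antisymm (ciSup_le upper) ?_
  refine le_ciSup_of_le ⟨_, Set.forall_mem_range.mpr upper⟩ (a ⟨k - 1, by omega⟩) ?_
  rw [← objective_eq (a ⟨k - 1, by omega⟩)]
  gcongr
  rw [Fin.sum_univ_add, Finset.sum_eq_zero (f := fun i : Fin m => max _ _), add_zero]
  · refine Finset.sum_le_sum fun i _ => max_le le_rfl (sub_nonneg.mpr (ha ?_))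
    simp only [Fin.le_def, Fin.val_castLE]
    omega
  · refine fun i _ => max_eq_right (sub_nonpos.mpr (ha ?_))
    simp only [Fin.le_def, Fin.val_natAdd]
    omega
end

section
/- Let (Z, 𝒜, P) be a probability space, M > 0, f : Z → [0, M] measurable, γ > 0, and z* ∈ Z. For ε ∈ [0,1) let P_ε = (1−ε)·P + ε·δ_{z*} (where δ_{z*} is the point mass at z*), and let ρ(ε) = sup_{λ∈ℝ} ( λ − ∫ φ_γ(λ − f(z)) dP_ε(z) ) be the inverted entropic risk of f under P_ε, where φ_γ(t) = (e^{γt} − 1)/γ. Then the limit as ε → 0⁺ of (ρ(ε) − ρ(0))/ε exists and equals 1/γ − (1/γ)·e^{−γ f(z*)} / ∫ e^{−γ f(z)} dP(z). -/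
open MeasureTheory Filter Set

theorem iSup_sub_exp_mul_eq {γ m : ℝ} (hγ : 0 < γ) (hm : 0 < m) :
    (⨆ lam : ℝ, (lam - (Real.exp (γ * lam) * m - 1) / γ)) = -Real.log m / γ := by
  refine IsLUB.ciSup_eq (IsGreatest.isLUB ⟨⟨-Real.log m / γ, ?_⟩, ?_⟩)
  · have h : γ * (-Real.log m / γ) = -Real.log m := by field_simp
    simp only [h, Real.exp_neg, Real.exp_log hm]
    simp [hm.ne']
  · rintro _ ⟨lam, rfl⟩
    have h : γ * lam + Real.log m + 1 ≤ Real.exp (γ * lam) * m := by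
      simpa [Real.exp_add, Real.exp_log hm] using Real.add_one_le_exp (γ * lam + Real.log m)
    have h' : lam - (Real.exp (γ * lam) * m - 1) / γ
        = (γ * lam - (Real.exp (γ * lam) * m - 1)) / γ := by field_simp
    simp only [h']
    gcongr
    linarith

/-- The inverted entropic risk is the negative exponential certainty equivalent. -/
theorem invertedEntropicRisk_eq {Z : Type*} [MeasurableSpace Z] (Q : Measure Z)
    [IsProbabilityMeasure Q] {f : Z → ℝ} {γ : ℝ} (hγ : 0 < γ)
    (hint : Integrable (fun z => Real.exp (-γ * f z)) Q) :
    (⨆ lam : ℝ, (lam - ∫ z, (Real.exp (γ * (lam - f z)) - 1) / γ ∂Q))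
      = -Real.log (∫ z, Real.exp (-γ * f z) ∂Q) / γ := by
  rw [← iSup_sub_exp_mul_eq hγ (integral_exp_pos hint)]
  congr 1 with lam
  have h (z : Z) : Real.exp (γ * (lam - f z)) = Real.exp (γ * lam) * Real.exp (-γ * f z) := by
    rw [← Real.exp_add]
    ring_nf
  simp only [h]
  rw [integral_div, integral_sub (hint.const_mul _) (integrable_const _), integral_const_mul]
  simp

theorem isProbabilityMeasure_contamination {Z : Type*} [MeasurableSpace Z] (P : Measure Z)
    [IsProbabilityMeasure P] (z : Z) {ε : ℝ} (h0 : 0 ≤ ε) (h1 : ε ≤ 1) :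
    IsProbabilityMeasure (ENNReal.ofReal (1 - ε) • P + ENNReal.ofReal ε • Measure.dirac z) := by
  constructor
  simp [← ENNReal.ofReal_add (sub_nonneg.2 h1) h0]

theorem integral_contamination {Z : Type*} [MeasurableSpace Z] (P : Measure Z) (z : Z)
    {g : Z → ℝ} (hg : Measurable g) (hint : Integrable g P) {ε : ℝ} (h0 : 0 ≤ ε) (h1 : ε ≤ 1) :
    ∫ x, g x ∂(ENNReal.ofReal (1 - ε) • P + ENNReal.ofReal ε • Measure.dirac z)
      = (1 - ε) * ∫ x, g x ∂P + ε * g z := by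
  have hdirac : Integrable g (Measure.dirac z) :=
    integrable_dirac' hg.stronglyMeasurable (by simp)
  rw [integral_add_measure (hint.smul_measure ENNReal.ofReal_ne_top)
      (hdirac.smul_measure ENNReal.ofReal_ne_top),
    integral_smul_measure, integral_smul_measure, integral_dirac' _ _ hg.stronglyMeasurable,
    ENNReal.toReal_ofReal h0, ENNReal.toReal_ofReal (sub_nonneg.2 h1), smul_eq_mul, smul_eq_mul]

/-- Influence function of the inverted entropic risk.  With
`P_ε = (1-ε)·P + ε·δ_{z*}` and `ρ(ε)` the inverted entropic risk
`sup_λ (λ − ∫ φ_γ(λ − f z) dP_ε)` where `φ_γ(t) = (e^{γt} − 1)/γ`, the one-sided derivative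
`lim_{ε→0⁺} (ρ(ε) − ρ(0))/ε` exists and equals
`1/γ − (1/γ)·e^{−γ f(z*)} / ∫ e^{−γ f} dP`. -/
theorem influence_inverted_entropic {Z : Type*} [MeasurableSpace Z]
    (P : Measure Z) [IsProbabilityMeasure P]
    (M : ℝ) (hM : 0 < M) (f : Z → ℝ) (hf : Measurable f)
    (hfb : ∀ z, f z ∈ Set.Icc 0 M) (γ : ℝ) (hγ : 0 < γ) (zstar : Z) :
    Filter.Tendsto
      (fun ε : ℝ =>
        ((⨆ lam : ℝ, (lam - ∫ z, (Real.exp (γ * (lam - f z)) - 1) / γ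
            ∂(ENNReal.ofReal (1 - ε) • P + ENNReal.ofReal ε • Measure.dirac zstar))) -
          (⨆ lam : ℝ, (lam - ∫ z, (Real.exp (γ * (lam - f z)) - 1) / γ ∂P))) / ε)
      (nhdsWithin 0 (Set.Ioi 0))
      (nhds (1 / γ - (1 / γ) * (Real.exp (-γ * f zstar) / ∫ z, Real.exp (-γ * f z) ∂P))) := by
  have hg : Measurable fun z => Real.exp (-γ * f z) := by fun_prop
  have hint (Q : Measure Z) [IsProbabilityMeasure Q] :
      Integrable (fun z => Real.exp (-γ * f z)) Q := by
    refine Integrable.of_bound hg.aestronglyMeasurable 1 (.of_forall fun z => ?_)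
    rw [Real.norm_eq_abs, Real.abs_exp, Real.exp_le_one_iff]
    nlinarith [(hfb z).1]
  set m := ∫ z, Real.exp (-γ * f z) ∂P with hm
  have hm0 : 0 < m := integral_exp_pos (hint P)
  set c := Real.exp (-γ * f zstar) with hc
  have hderiv : HasDerivAt (fun ε : ℝ => -Real.log ((1 - ε) * m + ε * c) / γ)
      (1 / γ - 1 / γ * (c / m)) 0 := by
    have hlin : HasDerivAt (fun ε : ℝ => (1 - ε) * m + ε * c) (-1 * m + 1 * c) 0 :=
      (((hasDerivAt_id (0 : ℝ)).const_sub 1).mul_const m).add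
        ((hasDerivAt_id (0 : ℝ)).mul_const c)
    refine ((hlin.log (by simpa using hm0.ne')).neg.div_const γ).congr_deriv ?_
    simp only [sub_zero, one_mul, zero_mul, add_zero]
    field_simp
    ring
  refine ((hasDerivWithinAt_iff_tendsto_slope' (s := Set.Ioi 0) (by simp)).1
    hderiv.hasDerivWithinAt).congr' ?_
  filter_upwards [Ioo_mem_nhdsGT (zero_lt_one (α := ℝ))] with ε hε
  have := isProbabilityMeasure_contamination P zstar hε.1.le hε.2.le
  rw [invertedEntropicRisk_eq _ hγ (hint _), invertedEntropicRisk_eq P hγ (hint P),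
    integral_contamination P zstar hg (hint P) hε.1.le hε.2.le, slope_def_field]
  simp [hm, hc]
end

section
/- Let (Z, 𝒜, P) be a probability space, M > 0, f : Z → [0, M] measurable, c > 0, and z* ∈ Z. For ε ∈ [0,1) let P_ε = (1−ε)·P + ε·δ_{z*}, and let ρ(ε) = sup_{λ∈ℝ} ( λ − ∫ φ_c(λ − f(z)) dP_ε(z) ) be the inverted mean-variance risk of f under P_ε, where φ_c(t) = t + c·t². Write R(f) = ∫ f dP and σ²(f) = ∫ (f − R(f))² dP. Then the limit as ε → 0⁺ of (ρ(ε) − ρ(0))/ε exists and equals f(z*) − R(f) + c·( σ²(f) − (f(z*) − R(f))² ). -/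
open MeasureTheory Filter Set

/-- The mean square deviation of `f` from a constant, in terms of the first two moments. -/
theorem integral_const_sub_sq {Z : Type*} [MeasurableSpace Z] (Q : Measure Z)
    [IsProbabilityMeasure Q] {f : Z → ℝ} (hf : Integrable f Q)
    (hf2 : Integrable (fun z => f z ^ 2) Q) (l : ℝ) :
    ∫ z, (l - f z) ^ 2 ∂Q = l ^ 2 - 2 * l * (∫ z, f z ∂Q) + ∫ z, f z ^ 2 ∂Q := by
  have h : (fun z => (l - f z) ^ 2) = fun z => (l ^ 2 - 2 * l * f z) + f z ^ 2 := by
    funext z; ring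
  have h1 : Integrable (fun z => l ^ 2 - 2 * l * f z) Q :=
    (integrable_const _).sub (hf.const_mul _)
  rw [h, integral_add h1 hf2,
    integral_sub (integrable_const _) (hf.const_mul _), integral_const_mul]
  simp

/-- The inverted mean-variance risk is the mean minus `c` times the variance. -/
theorem iSup_inverted_mean_variance {Z : Type*} [MeasurableSpace Z] (Q : Measure Z)
    [IsProbabilityMeasure Q] {f : Z → ℝ} (hf : Integrable f Q)
    (hf2 : Integrable (fun z => f z ^ 2) Q) {c : ℝ} (hc : 0 ≤ c) :
    (⨆ lam : ℝ, (lam - ∫ z, ((lam - f z) + c * (lam - f z) ^ 2) ∂Q)) =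
      (∫ z, f z ∂Q) - c * ((∫ z, f z ^ 2 ∂Q) - (∫ z, f z ∂Q) ^ 2) := by
  have key (lam : ℝ) : lam - ∫ z, ((lam - f z) + c * (lam - f z) ^ 2) ∂Q =
      (∫ z, f z ∂Q) - c * ((∫ z, f z ^ 2 ∂Q) - (∫ z, f z ∂Q) ^ 2)
        - c * (lam - ∫ z, f z ∂Q) ^ 2 := by
    have h2 : Integrable (fun z => (lam - f z) ^ 2) Q := by
      have h : (fun z => (lam - f z) ^ 2) = fun z => (lam ^ 2 - 2 * lam * f z) + f z ^ 2 := by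
        funext z; ring
      rw [h]
      exact ((integrable_const _).sub (hf.const_mul _)).add hf2
    have h1 : Integrable (fun z => lam - f z) Q := (integrable_const _).sub hf
    rw [integral_add h1 (h2.const_mul _),
      integral_sub (integrable_const _) hf, integral_const_mul, integral_const_sub_sq Q hf hf2]
    simp
    ring
  simp_rw [key]
  refine IsLUB.ciSup_eq (IsGreatest.isLUB ⟨⟨∫ z, f z ∂Q, by simp⟩, ?_⟩)
  rintro _ ⟨lam, rfl⟩
  have := mul_nonneg hc (sq_nonneg (lam - ∫ z, f z ∂Q))
  simp only
  linarith

/-- Integrals against a contaminated measure. -/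
theorem integral_contaminated {Z : Type*} [MeasurableSpace Z] (P : Measure Z) {g : Z → ℝ}
    (hg : Measurable g) (hgi : Integrable g P) (z₀ : Z) {ε : ℝ} (h0 : 0 ≤ ε) (h1 : ε ≤ 1) :
    ∫ z, g z ∂(ENNReal.ofReal (1 - ε) • P + ENNReal.ofReal ε • Measure.dirac z₀) =
      (1 - ε) * (∫ z, g z ∂P) + ε * g z₀ := by
  have hd : Integrable g (Measure.dirac z₀) :=
    integrable_dirac' hg.stronglyMeasurable (by simp)
  rw [integral_add_measure (hgi.smul_measure ENNReal.ofReal_ne_top)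
    (hd.smul_measure ENNReal.ofReal_ne_top), integral_smul_measure, integral_smul_measure,
    integral_dirac' _ _ hg.stronglyMeasurable, ENNReal.toReal_ofReal (by linarith),
    ENNReal.toReal_ofReal h0, smul_eq_mul, smul_eq_mul]

/-- Influence function of the inverted mean-variance risk.  With
`P_ε = (1-ε)·P + ε·δ_{z*}` and `ρ(ε)` the inverted mean-variance risk
`sup_λ (λ − ∫ φ_c(λ − f z) dP_ε)` where `φ_c(t) = t + c·t²`, the one-sided derivative
`lim_{ε→0⁺} (ρ(ε) − ρ(0))/ε` exists and equals
`f(z*) − R(f) + c·(σ²(f) − (f(z*) − R(f))²)`. -/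
theorem influence_inverted_mean_variance {Z : Type*} [MeasurableSpace Z]
    (P : Measure Z) [IsProbabilityMeasure P]
    (M : ℝ) (hM : 0 < M) (f : Z → ℝ) (hf : Measurable f)
    (hfb : ∀ z, f z ∈ Set.Icc 0 M) (c : ℝ) (hc : 0 < c) (zstar : Z) :
    Filter.Tendsto
      (fun ε : ℝ =>
        ((⨆ lam : ℝ, (lam - ∫ z, ((lam - f z) + c * (lam - f z) ^ 2)
            ∂(ENNReal.ofReal (1 - ε) • P + ENNReal.ofReal ε • Measure.dirac zstar))) -
          (⨆ lam : ℝ, (lam - ∫ z, ((lam - f z) + c * (lam - f z) ^ 2) ∂P))) / ε)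
      (nhdsWithin 0 (Set.Ioi 0))
      (nhds ((f zstar - ∫ z, f z ∂P) +
        c * ((∫ z, (f z - ∫ w, f w ∂P) ^ 2 ∂P) - (f zstar - ∫ z, f z ∂P) ^ 2))) := by
  have integrable_moments (Q : Measure Z) [IsProbabilityMeasure Q] :
      Integrable f Q ∧ Integrable (fun z => f z ^ 2) Q := by
    refine ⟨.of_bound hf.aestronglyMeasurable M (.of_forall fun z => ?_),
      .of_bound (hf.pow_const 2).aestronglyMeasurable (M ^ 2) (.of_forall fun z => ?_)⟩
    · rw [Real.norm_of_nonneg (hfb z).1]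
      exact (hfb z).2
    · rw [Real.norm_of_nonneg (sq_nonneg _)]
      exact pow_le_pow_left₀ (hfb z).1 (hfb z).2 2
  obtain ⟨hi, hi2⟩ := integrable_moments P
  have hvar : ∫ z, (f z - ∫ w, f w ∂P) ^ 2 ∂P = (∫ z, f z ^ 2 ∂P) - (∫ z, f z ∂P) ^ 2 := by
    simp_rw [sub_sq_comm (f _)]
    rw [integral_const_sub_sq P hi hi2]
    ring
  rw [hvar, iSup_inverted_mean_variance P hi hi2 hc.le]
  set m := ∫ z, f z ∂P
  set s := ∫ z, f z ^ 2 ∂P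
  set a := f zstar
  have hlim : Tendsto (fun ε : ℝ => (a - m) + c * ((s - m ^ 2) - (a - m) ^ 2)
      + ε * (c * (a - m) ^ 2)) (nhdsWithin 0 (Set.Ioi 0))
      (nhds ((a - m) + c * ((s - m ^ 2) - (a - m) ^ 2))) := by
    have h : Continuous (fun ε : ℝ => (a - m) + c * ((s - m ^ 2) - (a - m) ^ 2)
      + ε * (c * (a - m) ^ 2)) := by fun_prop
    simpa using (h.tendsto 0).mono_left nhdsWithin_le_nhds
  refine hlim.congr' ?_
  filter_upwards [Ioo_mem_nhdsGT (zero_lt_one' ℝ)] with ε hε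
  have hprob : IsProbabilityMeasure
      (ENNReal.ofReal (1 - ε) • P + ENNReal.ofReal ε • Measure.dirac zstar) := by
    constructor
    simp only [Measure.add_apply, Measure.smul_apply, measure_univ, smul_eq_mul, mul_one]
    rw [← ENNReal.ofReal_add (by linarith [hε.2]) hε.1.le]
    simp
  obtain ⟨hj, hj2⟩ := integrable_moments
    (ENNReal.ofReal (1 - ε) • P + ENNReal.ofReal ε • Measure.dirac zstar)
  rw [iSup_inverted_mean_variance _ hj hj2 hc.le,
    integral_contaminated P hf hi zstar hε.1.le hε.2.le,
    integral_contaminated P (hf.pow_const 2) hi2 zstar hε.1.le hε.2.le,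
    eq_div_iff hε.1.ne']
  ring
end

section
/- Let (Z, 𝒜, P) be a probability space, M > 0, and let F be a countable nonempty set of measurable functions f : Z → [0, M]. Let φ : ℝ → ℝ be a disutility function that is Lipschitz with constant L. Then for every n ≥ 1 and δ ∈ (0,1], the n-fold product measure P^n of the set of samples (z₁,...,zₙ) ∈ Z^n satisfying sup_{f∈F} | OCE_φ(f;P) − OCE_φ(f;P_n) | ≤ L·( 2·E_{P^n}[Rad_n(F(Z^n))] + M·(2 + √(log(2/δ)))/√n ) is at least 1 − δ, where P_n is the empirical measure of (z₁,...,zₙ). -/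
open MeasureTheory Finset Set ENNReal

/-- A disutility function: nondecreasing, convex, `φ(0) = 0`, and `1 ∈ ∂φ(0)` (i.e. `φ(t) ≥ t`). -/
def IsDisutility (φ : ℝ → ℝ) : Prop :=
  Monotone φ ∧ ConvexOn ℝ Set.univ φ ∧ φ 0 = 0 ∧ ∀ t : ℝ, t ≤ φ t

/-- The optimized certainty equivalent risk `OCE_φ(f;Q) = inf_λ (λ + ∫ φ(f − λ) dQ)`. -/
noncomputable def OCE {Z : Type*} [MeasurableSpace Z] (φ : ℝ → ℝ) (f : Z → ℝ) (Q : Measure Z) : ℝ :=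
  ⨅ lam : ℝ, (lam + ∫ z, φ (f z - lam) ∂Q)

/-- The inverted OCE risk `IOCE_φ(f;Q) = sup_λ (λ − ∫ φ(λ − f) dQ)`. -/
noncomputable def IOCE {Z : Type*} [MeasurableSpace Z] (φ : ℝ → ℝ) (f : Z → ℝ) (Q : Measure Z) : ℝ :=
  ⨆ lam : ℝ, (lam - ∫ z, φ (lam - f z) ∂Q)

/-- The empirical measure `(1/n)·Σᵢ δ_{zᵢ}` of a sample `z : Fin n → Z`. -/
noncomputable def empMeas {Z : Type*} [MeasurableSpace Z] {n : ℕ} (z : Fin n → Z) : Measure Z :=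
  (n : ℝ≥0∞)⁻¹ • ∑ i : Fin n, Measure.dirac (z i)

/-- The Rademacher average of a function class `F` on a sample `z`:
`2^{-n}·Σ_{ε ∈ {−1,1}ⁿ} sup_{f∈F} (1/n)·Σᵢ εᵢ f(zᵢ)`. -/
noncomputable def rad {Z : Type*} {n : ℕ} (F : Set (Z → ℝ)) (z : Fin n → Z) : ℝ :=
  (2 ^ n : ℝ)⁻¹ * ∑ ε : Fin n → Bool,
    ⨆ f : F, (n : ℝ)⁻¹ * ∑ i : Fin n, (if ε i then (1 : ℝ) else -1) * (f : Z → ℝ) (z i)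

/-! ### Signed sums and the contraction principle -/

/-- The sign `±1` attached to a Boolean. -/
noncomputable def boolSign (b : Bool) : ℝ := if b then 1 else -1

@[simp] lemma boolSign_true : boolSign true = 1 := by simp [boolSign]

@[simp] lemma boolSign_false : boolSign false = -1 := by simp [boolSign]

lemma boolSign_not (b : Bool) : boolSign (!b) = -boolSign b := by cases b <;> simp

lemma abs_boolSign (b : Bool) : |boolSign b| = 1 := by cases b <;> simp

lemma sum_fin_succ_bool {n : ℕ} (g : (Fin (n + 1) → Bool) → ℝ) :
    ∑ ε, g ε = ∑ ε : Fin n → Bool, (g (Fin.cons true ε) + g (Fin.cons false ε)) := by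
  rw [← (Fin.consEquiv fun _ => Bool).sum_comp, Fintype.sum_prod_type_right]
  simp [Fin.consEquiv]

lemma bddAbove_range_of_abs_le {ι : Type*} {g : ι → ℝ} {B : ℝ} (h : ∀ i, |g i| ≤ B) :
    BddAbove (range g) :=
  ⟨B, by rintro _ ⟨i, rfl⟩; exact (abs_le.1 (h i)).2⟩

lemma abs_iSup_le_of_abs_le {ι : Type*} [Nonempty ι] {g : ι → ℝ} {B : ℝ} (h : ∀ i, |g i| ≤ B) :
    |⨆ i, g i| ≤ B := by
  obtain ⟨i⟩ := ‹Nonempty ι›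
  have : Nonempty ι := ⟨i⟩
  exact abs_le.2 ⟨(abs_le.1 (h i)).1.trans (le_ciSup (bddAbove_range_of_abs_le h) i),
    ciSup_le fun i => (abs_le.1 (h i)).2⟩

lemma iSup_contraction {ι : Type*} [Nonempty ι] (b t : ι → ℝ) (ψ : ℝ → ℝ) (L B : ℝ)
    (hψ : ∀ x y, |ψ x - ψ y| ≤ L * |x - y|)
    (hp : ∀ i, |b i + L * t i| ≤ B) (hm : ∀ i, |b i - L * t i| ≤ B) :
    (⨆ i, (b i + ψ (t i))) + (⨆ i, (b i - ψ (t i))) ≤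
      (⨆ i, (b i + L * t i)) + ⨆ i, (b i - L * t i) := by
  rw [← le_sub_iff_add_le]
  refine ciSup_le fun i => ?_
  rw [le_sub_comm]
  refine ciSup_le fun k => ?_
  have hψ' := (abs_le.1 (hψ (t i) (t k))).2
  have h1 := le_ciSup (bddAbove_range_of_abs_le hp)
  have h2 := le_ciSup (bddAbove_range_of_abs_le hm)
  rcases abs_cases (t i - t k) with ⟨h, _⟩ | ⟨h, _⟩ <;> rw [h] at hψ'
  · linarith [h1 i, h2 k]
  · linarith [h1 k, h2 i]

lemma abs_signed_sum_le {n : ℕ} {ε : Fin n → Bool} {t : Fin n → ℝ} {B : ℝ}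
    (h : ∀ j, |t j| ≤ B) : |∑ j, boolSign (ε j) * t j| ≤ n * B := by
  refine (Finset.abs_sum_le_sum_abs _ _).trans ?_
  refine (Finset.sum_le_sum fun j _ => ?_).trans_eq (b := ∑ _j : Fin n, B) (by simp)
  rw [abs_mul, abs_boolSign, one_mul]
  exact h j

/-- The contraction principle for Rademacher averages, with offsets `a`. -/
lemma sum_iSup_contraction {ι : Type*} [Nonempty ι] {n : ℕ} (a : ι → ℝ) (T : ι → Fin n → ℝ)
    (ψ : ℝ → ℝ) (L A B C : ℝ) (hψ : ∀ x y, |ψ x - ψ y| ≤ L * |x - y|)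
    (ha : ∀ i, |a i| ≤ A) (hT : ∀ i j, |T i j| ≤ B) (hψT : ∀ i j, |ψ (T i j)| ≤ C) :
    ∑ ε : Fin n → Bool, ⨆ i, (a i + ∑ j, boolSign (ε j) * ψ (T i j)) ≤
      ∑ ε : Fin n → Bool, ⨆ i, (a i + L * ∑ j, boolSign (ε j) * T i j) := by
  induction n generalizing a A with
  | zero => simp
  | succ n ih =>
    rw [sum_fin_succ_bool, sum_fin_succ_bool]
    simp only [Fin.sum_univ_succ, Fin.cons_zero, Fin.cons_succ, boolSign_true, boolSign_false,
      one_mul, neg_mul]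
    rw [Finset.sum_add_distrib]
    have hpos := ih (fun i => a i + ψ (T i 0)) (fun i j => T i j.succ) (A + C)
      (fun i => (abs_add_le _ _).trans (add_le_add (ha i) (hψT i 0)))
      (fun i j => hT i j.succ) (fun i j => hψT i j.succ)
    have hneg := ih (fun i => a i - ψ (T i 0)) (fun i j => T i j.succ) (A + C)
      (fun i => (abs_sub _ _).trans (add_le_add (ha i) (hψT i 0)))
      (fun i j => hT i j.succ) (fun i j => hψT i j.succ)
    simp only [← add_assoc, ← sub_eq_add_neg]
    refine (add_le_add hpos hneg).trans ?_
    rw [← Finset.sum_add_distrib]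
    refine Finset.sum_le_sum fun ε _ => ?_
    have hsum : ∀ i, |L * ∑ j, boolSign (ε j) * T i j.succ| ≤ |L| * (n * B) := fun i => by
      rw [abs_mul]
      exact mul_le_mul_of_nonneg_left (abs_signed_sum_le fun j => hT i j.succ) (abs_nonneg _)
    have hL0 : ∀ i, |L * T i 0| ≤ |L| * B := fun i => by
      rw [abs_mul]
      exact mul_le_mul_of_nonneg_left (hT i 0) (abs_nonneg _)
    have h := iSup_contraction (fun i => a i + L * ∑ j, boolSign (ε j) * T i j.succ)
      (fun i => T i 0) ψ L (A + |L| * (n * B) + |L| * B) hψ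
      (fun i => (abs_add_le _ _).trans
        (add_le_add ((abs_add_le _ _).trans (add_le_add (ha i) (hsum i))) (hL0 i)))
      (fun i => (abs_sub _ _).trans
        (add_le_add ((abs_add_le _ _).trans (add_le_add (ha i) (hsum i))) (hL0 i)))
    refine (Eq.le ?_).trans (h.trans (Eq.le ?_)) <;>
      refine congrArg₂ (· + ·) (iSup_congr fun i => ?_) (iSup_congr fun i => ?_) <;> ring

lemma sum_signed_sum_sq (n : ℕ) :
    ∑ ε : Fin n → Bool, (∑ j, boolSign (ε j)) ^ 2 = 2 ^ n * n := by
  induction n with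
  | zero => simp
  | succ n ih =>
    rw [sum_fin_succ_bool]
    simp only [Fin.sum_univ_succ, Fin.cons_zero, Fin.cons_succ, boolSign_true, boolSign_false]
    have : ∀ x : ℝ, (1 + x) ^ 2 + (-1 + x) ^ 2 = 2 * x ^ 2 + 2 := fun x => by ring
    simp only [this, Finset.sum_add_distrib, ← Finset.mul_sum, ih]
    simp
    ring

lemma sum_abs_signed_sum_le (n : ℕ) :
    ∑ ε : Fin n → Bool, |∑ j, boolSign (ε j)| ≤ 2 ^ n * √n := by
  have h := sq_sum_le_card_mul_sum_sq (s := (Finset.univ : Finset (Fin n → Bool)))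
    (f := fun ε => |∑ j, boolSign (ε j)|)
  simp only [sq_abs, sum_signed_sum_sq, Finset.card_univ, Fintype.card_fun, Fintype.card_bool,
    Fintype.card_fin] at h
  refine abs_le_of_sq_le_sq' ?_ (by positivity) |>.2
  rw [mul_pow, Real.sq_sqrt (by positivity)]
  push_cast at h
  linarith

/-! ### The bounded differences inequality -/

/-- Hoeffding's lemma for a function of oscillation at most `c`. -/
lemma integral_exp_sub_mean_le_of_oscillation {Ω : Type*} [MeasurableSpace Ω] (μ : Measure Ω)
    [IsProbabilityMeasure μ] {g : Ω → ℝ} (hg : Measurable g) {c : ℝ}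
    (hc : ∀ x y, |g x - g y| ≤ c) (s : ℝ) :
    ∫ x, Real.exp (s * (g x - ∫ y, g y ∂μ)) ∂μ ≤ Real.exp (s ^ 2 * c ^ 2 / 8) := by
  obtain ⟨x₀⟩ := nonempty_of_isProbabilityMeasure μ
  have hbd : BddBelow (range g) :=
    ⟨g x₀ - c, by rintro _ ⟨x, rfl⟩; linarith [(abs_le.1 (hc x x₀)).1]⟩
  have hmem : ∀ x, g x ∈ Set.Icc (⨅ y, g y) ((⨅ y, g y) + c) := fun x => by
    have : Nonempty Ω := ⟨x₀⟩
    refine ⟨ciInf_le hbd x, ?_⟩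
    rw [← sub_le_iff_le_add]
    exact le_ciInf fun y => by linarith [(abs_le.1 (hc x y)).2]
  have h := (ProbabilityTheory.hasSubgaussianMGF_of_mem_Icc (μ := μ) hg.aemeasurable
    (Filter.Eventually.of_forall hmem)).mgf_le s
  simp only [ProbabilityTheory.mgf] at h
  refine h.trans_eq ?_
  congr 1
  simp only [add_sub_cancel_left]
  push_cast
  rw [Real.norm_eq_abs, div_pow, sq_abs]
  ring

/-- Moment generating function bound for functions with bounded differences. -/
lemma integral_exp_sub_mean_le_of_boundedDifferences {Z : Type*} [MeasurableSpace Z]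
    (P : Measure Z) [IsProbabilityMeasure P] (c s : ℝ) {n : ℕ} {G : (Fin n → Z) → ℝ}
    (hG : Measurable G) {B : ℝ} (hB : ∀ z, |G z| ≤ B)
    (hc : ∀ z j x, |G (Function.update z j x) - G z| ≤ c) :
    ∫ z, Real.exp (s * (G z - ∫ w, G w ∂(Measure.pi fun _ => P))) ∂(Measure.pi fun _ => P) ≤
      Real.exp (s ^ 2 * (n * c ^ 2) / 8) := by
  induction n with
  | zero =>
    have hconst : G = fun _ => G Fin.elim0 := funext fun z => congrArg G (Subsingleton.elim _ _)
    rw [hconst]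
    simp
  | succ n ih =>
    set μ : Measure (Fin n → Z) := Measure.pi fun _ => P
    have hcons : Measurable fun p : Z × (Fin n → Z) => (Fin.cons p.1 p.2 : Fin (n + 1) → Z) :=
      measurable_pi_iff.2 fun i => by
        refine Fin.cases ?_ (fun j => ?_) i
        · simpa using measurable_fst
        · simp only [Fin.cons_succ]
          fun_prop
    have hsplit : ∀ H : (Fin (n + 1) → Z) → ℝ, Measurable H → (∃ C, ∀ z, |H z| ≤ C) →
        ∫ z, H z ∂(Measure.pi fun _ => P) = ∫ x, ∫ y, H (Fin.cons x y) ∂μ ∂P := by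
      rintro H hH ⟨C, hC⟩
      have hmp := (measurePreserving_piFinSuccAbove (fun _ : Fin (n + 1) => P) 0).symm
      rw [← hmp.integral_comp', integral_prod]
      · simp [MeasurableEquiv.piFinSuccAbove, Fin.insertNthEquiv, μ]
      · exact Integrable.of_bound
          (hH.comp (MeasurableEquiv.measurable _)).aestronglyMeasurable C
          (Filter.Eventually.of_forall fun p => hC _)
    have hGc : Measurable fun p : Z × (Fin n → Z) => G (Fin.cons p.1 p.2) := hG.comp hcons
    have hGx : ∀ x, Measurable fun y : Fin n → Z => G (Fin.cons x y) := fun x =>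
      hGc.comp measurable_prodMk_left
    have hGint : ∀ x, Integrable (fun y : Fin n → Z => G (Fin.cons x y)) μ := fun x =>
      Integrable.of_bound (hGx x).aestronglyMeasurable B
        (Filter.Eventually.of_forall fun y => hB _)
    set g : Z → ℝ := fun x => ∫ y, G (Fin.cons x y) ∂μ with hg
    have hgm : Measurable g := hGc.stronglyMeasurable.integral_prod_right.measurable
    have hgc : ∀ x x', |g x - g x'| ≤ c := fun x x' => by
      rw [hg, ← integral_sub (hGint x) (hGint x')]
      have hle : ∀ y : Fin n → Z, ‖G (Fin.cons x y) - G (Fin.cons x' y)‖ ≤ c := fun y => by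
        have := hc (Fin.cons x' y) 0 x
        rwa [Fin.update_cons_zero] at this
      simpa using norm_integral_le_of_norm_le_const (μ := μ) (Filter.Eventually.of_forall hle)
    have hexp : ∃ C, ∀ z, |Real.exp (s * (G z - ∫ w, G w ∂(Measure.pi fun _ => P)))| ≤ C := by
      refine ⟨Real.exp (|s| * (B + |∫ w, G w ∂(Measure.pi fun _ => P)|)), fun z => ?_⟩
      rw [Real.abs_exp, Real.exp_le_exp]
      refine (le_abs_self _).trans ?_
      rw [abs_mul]
      exact mul_le_mul_of_nonneg_left ((abs_sub _ _).trans (by linarith [hB z])) (abs_nonneg s)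
    rw [hsplit _ (by fun_prop) hexp, hsplit G hG ⟨B, hB⟩]
    change ∫ x, ∫ y, Real.exp (s * (G (Fin.cons x y) - ∫ x', g x' ∂P)) ∂μ ∂P ≤ _
    have hinner : ∀ x, ∫ y, Real.exp (s * (G (Fin.cons x y) - ∫ x', g x' ∂P)) ∂μ ≤
        Real.exp (s ^ 2 * (n * c ^ 2) / 8) * Real.exp (s * (g x - ∫ x', g x' ∂P)) := fun x => by
      have h := ih (G := fun y => G (Fin.cons x y)) (hGx x) (fun y => hB _) (fun y j x' => by
        have := hc (Fin.cons x y) j.succ x'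
        rwa [← Fin.cons_update] at this)
      refine le_trans (le_of_eq ?_) (mul_le_mul_of_nonneg_right h (Real.exp_pos _).le)
      rw [← integral_mul_const]
      refine integral_congr_ae (Filter.Eventually.of_forall fun y => ?_)
      simp only
      rw [← Real.exp_add]
      congr 1
      change _ = s * (_ - g x) + _
      ring
    have hgB : ∀ x, |g x| ≤ B := fun x => by
      have hle : ∀ y : Fin n → Z, ‖G (Fin.cons x y)‖ ≤ B := fun y => hB _
      simpa using norm_integral_le_of_norm_le_const (μ := μ) (Filter.Eventually.of_forall hle)
    have houter : Integrable (fun x => Real.exp (s * (g x - ∫ x', g x' ∂P))) P := by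
      refine Integrable.of_bound (by fun_prop)
        (Real.exp (|s| * (B + |∫ x', g x' ∂P|))) (Filter.Eventually.of_forall fun x => ?_)
      rw [Real.norm_eq_abs, Real.abs_exp, Real.exp_le_exp]
      refine (le_abs_self _).trans ?_
      rw [abs_mul]
      exact mul_le_mul_of_nonneg_left ((abs_sub _ _).trans (by linarith [hgB x])) (abs_nonneg s)
    refine (integral_mono_of_nonneg (Filter.Eventually.of_forall fun x => ?_)
      (houter.const_mul _) (Filter.Eventually.of_forall hinner)).trans ?_
    · exact integral_nonneg fun y => (Real.exp_pos _).le
    · rw [integral_const_mul]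
      refine (mul_le_mul_of_nonneg_left
        (integral_exp_sub_mean_le_of_oscillation P hgm hgc s) (Real.exp_pos _).le).trans_eq ?_
      rw [← Real.exp_add]
      congr 1
      push_cast
      ring

/-- McDiarmid's inequality, in a form with a slightly weaker constant than the optimal one. -/
lemma measureReal_add_le_of_boundedDifferences {Z : Type*} [MeasurableSpace Z]
    (P : Measure Z) [IsProbabilityMeasure P] {c : ℝ} (hc0 : 0 < c) {n : ℕ} (hn : 1 ≤ n)
    {G : (Fin n → Z) → ℝ} (hG : Measurable G) {B : ℝ} (hB : ∀ z, |G z| ≤ B)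
    (hc : ∀ z j x, |G (Function.update z j x) - G z| ≤ c) {x : ℝ} (hx : 0 ≤ x) :
    (Measure.pi fun _ : Fin n => P).real
      {z | ∫ w, G w ∂(Measure.pi fun _ => P) + c * √n * √x ≤ G z} ≤ Real.exp (-x) := by
  set μ : Measure (Fin n → Z) := Measure.pi fun _ => P
  set m := ∫ w, G w ∂μ
  have hn0 : (0 : ℝ) < n := by exact_mod_cast hn
  have hsn : 0 < √(n : ℝ) := Real.sqrt_pos.2 hn0
  set s := 2 * √x / (c * √n) with hs
  have hs0 : 0 ≤ s := by positivity
  have hint : Integrable (fun z => Real.exp (s * (G z - m))) μ := by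
    refine Integrable.of_bound (by fun_prop) (Real.exp (|s| * (B + |m|)))
      (Filter.Eventually.of_forall fun z => ?_)
    rw [Real.norm_eq_abs, Real.abs_exp, Real.exp_le_exp]
    refine (le_abs_self _).trans ?_
    rw [abs_mul]
    exact mul_le_mul_of_nonneg_left ((abs_sub _ _).trans (by linarith [hB z])) (abs_nonneg s)
  have h := ProbabilityTheory.measure_ge_le_exp_mul_mgf (μ := μ) (X := fun z => G z - m)
    (c * √n * √x) hs0 hint
  have hmgf := integral_exp_sub_mean_le_of_boundedDifferences P c s hG hB hc
  have hset : {z | m + c * √n * √x ≤ G z} = {z | c * √n * √x ≤ G z - m} := by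
    ext z
    simp only [Set.mem_ofPred_eq]
    constructor <;> intro _ <;> linarith
  rw [hset]
  refine h.trans ((mul_le_mul_of_nonneg_left hmgf (Real.exp_pos _).le).trans ?_)
  rw [← Real.exp_add, Real.exp_le_exp]
  have h1 : s * (c * √n * √x) = 2 * x := by
    rw [hs]
    field_simp
    rw [Real.sq_sqrt hx]
  have h2 : s ^ 2 * (n * c ^ 2) = 4 * x := by
    rw [hs, div_pow, mul_pow, mul_pow, Real.sq_sqrt hx, Real.sq_sqrt hn0.le]
    field_simp
    ring
  rw [neg_mul, h1, h2]
  linarith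

/-! ### Symmetrization -/

/-- The Rademacher average of an indexed family on a sample. -/
noncomputable def familyRad {ι Z : Type*} {n : ℕ} (h : ι → Z → ℝ) (z : Fin n → Z) : ℝ :=
  (2 ^ n : ℝ)⁻¹ * ∑ ε : Fin n → Bool, ⨆ i, (n : ℝ)⁻¹ * ∑ j, boolSign (ε j) * h i (z j)

/-- The largest one-sided deviation of the empirical means of a family. -/
noncomputable def deviation {ι Z : Type*} [MeasurableSpace Z] {n : ℕ} (P : Measure Z)
    (h : ι → Z → ℝ) (z : Fin n → Z) : ℝ :=
  ⨆ i, (∫ x, h i x ∂P - (n : ℝ)⁻¹ * ∑ j, h i (z j))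

lemma abs_inv_mul_le_of_abs_le {n : ℕ} (hn : 1 ≤ n) {a B : ℝ} (h : |a| ≤ n * B) :
    |(n : ℝ)⁻¹ * a| ≤ B := by
  have hn0 : (0 : ℝ) < n := by exact_mod_cast hn
  rw [abs_mul, abs_of_pos (inv_pos.2 hn0), inv_mul_le_iff₀ hn0]
  exact h

lemma abs_sum_le_card_mul {n : ℕ} {t : Fin n → ℝ} {B : ℝ} (h : ∀ j, |t j| ≤ B) :
    |∑ j, t j| ≤ n * B :=
  (Finset.abs_sum_le_sum_abs _ _).trans
    ((Finset.sum_le_sum fun j _ => h j).trans_eq (by simp))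

lemma abs_integral_le_of_abs_le {Z : Type*} [MeasurableSpace Z] (P : Measure Z)
    [IsProbabilityMeasure P] {f : Z → ℝ} {B : ℝ} (hB : ∀ z, |f z| ≤ B) : |∫ x, f x ∂P| ≤ B := by
  simpa using norm_integral_le_of_norm_le_const (μ := P) (f := f) (Filter.Eventually.of_forall hB)

lemma integrable_of_abs_le {Z : Type*} [MeasurableSpace Z] {P : Measure Z}
    [IsProbabilityMeasure P] {f : Z → ℝ} {B : ℝ} (hf : Measurable f) (hB : ∀ z, |f z| ≤ B) :
    Integrable f P :=
  Integrable.of_bound hf.aestronglyMeasurable B (Filter.Eventually.of_forall hB)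

lemma abs_deviation_term_le {ι Z : Type*} [MeasurableSpace Z] (P : Measure Z)
    [IsProbabilityMeasure P] {h : ι → Z → ℝ} {B : ℝ} {n : ℕ} (hn : 1 ≤ n)
    (hB : ∀ i z, |h i z| ≤ B) (z : Fin n → Z) (i : ι) :
    |∫ x, h i x ∂P - (n : ℝ)⁻¹ * ∑ j, h i (z j)| ≤ B + B :=
  (abs_sub _ _).trans (add_le_add (abs_integral_le_of_abs_le P (hB i))
    (abs_inv_mul_le_of_abs_le hn (abs_sum_le_card_mul fun j => hB i (z j))))

lemma measurable_deviation {ι Z : Type*} [Countable ι] [MeasurableSpace Z] (P : Measure Z)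
    {h : ι → Z → ℝ} (n : ℕ) (hm : ∀ i, Measurable (h i)) :
    Measurable fun z : Fin n → Z => deviation P h z :=
  Measurable.iSup fun i => by
    have := hm i
    fun_prop

lemma abs_signed_mean_le {ι Z : Type*} {h : ι → Z → ℝ} {B : ℝ} {n : ℕ} (hn : 1 ≤ n)
    (hB : ∀ i z, |h i z| ≤ B) (ε : Fin n → Bool) (z : Fin n → Z) (i : ι) :
    |(n : ℝ)⁻¹ * ∑ j, boolSign (ε j) * h i (z j)| ≤ B :=
  abs_inv_mul_le_of_abs_le hn (abs_signed_sum_le fun j => hB i (z j))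

lemma measurable_iSup_signed_mean {ι Z : Type*} [Countable ι] [MeasurableSpace Z]
    {h : ι → Z → ℝ} {n : ℕ} (hm : ∀ i, Measurable (h i)) (ε : Fin n → Bool) :
    Measurable fun z : Fin n → Z => ⨆ i, (n : ℝ)⁻¹ * ∑ j, boolSign (ε j) * h i (z j) :=
  Measurable.iSup fun i => by
    have := hm i
    fun_prop

lemma integrable_iSup_signed_mean {ι Z : Type*} [Countable ι] [Nonempty ι] [MeasurableSpace Z]
    (P : Measure Z) [IsProbabilityMeasure P] {h : ι → Z → ℝ} {B : ℝ} {n : ℕ} (hn : 1 ≤ n)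
    (hm : ∀ i, Measurable (h i)) (hB : ∀ i z, |h i z| ≤ B) (ε : Fin n → Bool) :
    Integrable (fun z : Fin n → Z => ⨆ i, (n : ℝ)⁻¹ * ∑ j, boolSign (ε j) * h i (z j))
      (Measure.pi fun _ => P) :=
  integrable_of_abs_le (measurable_iSup_signed_mean hm ε)
    fun z => abs_iSup_le_of_abs_le (abs_signed_mean_le hn hB ε z)

lemma integrable_familyRad {ι Z : Type*} [Countable ι] [Nonempty ι] [MeasurableSpace Z]
    (P : Measure Z) [IsProbabilityMeasure P] {h : ι → Z → ℝ} {B : ℝ} {n : ℕ} (hn : 1 ≤ n)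
    (hm : ∀ i, Measurable (h i)) (hB : ∀ i z, |h i z| ≤ B) :
    Integrable (fun z : Fin n → Z => familyRad h z) (Measure.pi fun _ => P) :=
  (integrable_finsetSum _ fun ε _ => integrable_iSup_signed_mean P hn hm hB ε).const_mul _

lemma iSup_signed_mean_sub_le {ι Z : Type*} [Nonempty ι] {h : ι → Z → ℝ} {B : ℝ} {n : ℕ}
    (hn : 1 ≤ n) (hB : ∀ i z, |h i z| ≤ B) (ε : Fin n → Bool) (z z' : Fin n → Z) :
    ⨆ i, (n : ℝ)⁻¹ * ∑ j, boolSign (ε j) * (h i (z j) - h i (z' j)) ≤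
      (⨆ i, (n : ℝ)⁻¹ * ∑ j, boolSign (ε j) * h i (z j)) +
        ⨆ i, (n : ℝ)⁻¹ * ∑ j, boolSign (!ε j) * h i (z' j) := by
  refine ciSup_le fun i => ?_
  have h1 := le_ciSup (bddAbove_range_of_abs_le (abs_signed_mean_le hn hB ε z)) i
  have h2 := le_ciSup (bddAbove_range_of_abs_le
    (abs_signed_mean_le hn hB (fun j => !ε j) z')) i
  refine le_trans (le_of_eq ?_) (add_le_add h1 h2)
  simp only [boolSign_not, mul_sub, Finset.sum_sub_distrib, neg_mul, Finset.sum_neg_distrib]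
  ring

/-- Comparison of the deviation with its version for an independent second sample. -/
lemma integral_deviation_le_integral_pair {ι Z : Type*} [Countable ι] [Nonempty ι]
    [MeasurableSpace Z] (P : Measure Z) [IsProbabilityMeasure P] {h : ι → Z → ℝ} {B : ℝ} {n : ℕ}
    (hn : 1 ≤ n) (hm : ∀ i, Measurable (h i)) (hB : ∀ i z, |h i z| ≤ B) :
    ∫ z : Fin n → Z, deviation P h z ∂(Measure.pi fun _ => P) ≤
      ∫ w : Fin n → Z × Z, ⨆ i, (n : ℝ)⁻¹ * ∑ j, (h i (w j).2 - h i (w j).1)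
        ∂(Measure.pi fun _ => P.prod P) := by
  set μ : Measure (Fin n → Z) := Measure.pi fun _ => P
  have hn0 : (n : ℝ) ≠ 0 := by positivity
  have hterm : ∀ (z z' : Fin n → Z) (i : ι),
      |(n : ℝ)⁻¹ * ∑ j, (h i (z' j) - h i (z j))| ≤ B + B := fun z z' i =>
    abs_inv_mul_le_of_abs_le hn (abs_sum_le_card_mul fun j =>
      (abs_sub _ _).trans (add_le_add (hB i _) (hB i _)))
  have hmeas : Measurable fun p : (Fin n → Z) × (Fin n → Z) =>
      ⨆ i, (n : ℝ)⁻¹ * ∑ j, (h i (p.2 j) - h i (p.1 j)) :=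
    Measurable.iSup fun i => by
      have := hm i
      fun_prop
  have hint : Integrable (fun p : (Fin n → Z) × (Fin n → Z) =>
      ⨆ i, (n : ℝ)⁻¹ * ∑ j, (h i (p.2 j) - h i (p.1 j))) (μ.prod μ) :=
    integrable_of_abs_le hmeas fun p => abs_iSup_le_of_abs_le (hterm p.1 p.2)
  have hmp := measurePreserving_arrowProdEquivProdArrow Z Z (Fin n) (fun _ => P) (fun _ => P)
  have hpair := hmp.integral_comp' (fun p : (Fin n → Z) × (Fin n → Z) =>
      ⨆ i, (n : ℝ)⁻¹ * ∑ j, (h i (p.2 j) - h i (p.1 j)))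
  refine le_trans ?_ hpair.ge
  rw [integral_prod _ hint]
  refine integral_mono (integrable_of_abs_le (measurable_deviation P n hm)
    fun z => abs_iSup_le_of_abs_le (abs_deviation_term_le P hn hB z)) hint.integral_prod_left
    fun z => ciSup_le fun i => ?_
  have hcoord : ∀ j, Integrable (fun z' : Fin n → Z => h i (z' j)) μ := fun j =>
    integrable_of_abs_le ((hm i).comp (measurable_pi_apply j)) fun z' => hB i _
  have hmean : ∫ z', (n : ℝ)⁻¹ * ∑ j, (h i (z' j) - h i (z j)) ∂μ =
      ∫ x, h i x ∂P - (n : ℝ)⁻¹ * ∑ j, h i (z j) := by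
    have hsub : ∀ j, Integrable (fun z' : Fin n → Z => h i (z' j) - h i (z j)) μ := fun j =>
      (hcoord j).sub (integrable_const _)
    rw [integral_const_mul, integral_finsetSum _ fun j _ => hsub j]
    have hj : ∀ j, ∫ z' : Fin n → Z, (h i (z' j) - h i (z j)) ∂μ =
        ∫ x, h i x ∂P - h i (z j) := fun j => by
      rw [integral_sub (hcoord j) (integrable_const _)]
      have he := integral_comp_eval (μ := fun _ : Fin n => P) (i := j)
        (hm i).aestronglyMeasurable
      rw [he]
      simp [μ]
    simp only [hj, Finset.sum_sub_distrib, Finset.sum_const, Finset.card_univ, Fintype.card_fin,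
      nsmul_eq_mul]
    field_simp
  rw [← hmean]
  refine integral_mono (integrable_of_abs_le (by have := hm i; fun_prop) (hterm z · i)) ?_
    fun z' => le_ciSup (bddAbove_range_of_abs_le (hterm z z')) i
  exact integrable_of_abs_le (hmeas.comp measurable_prodMk_left)
    fun z' => abs_iSup_le_of_abs_le (hterm z z')

/-- The expected deviation is at most twice the expected Rademacher average. -/
lemma integral_deviation_le {ι Z : Type*} [Countable ι] [Nonempty ι]
    [MeasurableSpace Z] (P : Measure Z) [IsProbabilityMeasure P] {h : ι → Z → ℝ} {B : ℝ} {n : ℕ}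
    (hn : 1 ≤ n) (hm : ∀ i, Measurable (h i)) (hB : ∀ i z, |h i z| ≤ B) :
    ∫ z : Fin n → Z, deviation P h z ∂(Measure.pi fun _ => P) ≤
      2 * ∫ z : Fin n → Z, familyRad h z ∂(Measure.pi fun _ => P) := by
  set μ : Measure (Fin n → Z) := Measure.pi fun _ => P
  set ν : Measure (Fin n → Z × Z) := Measure.pi fun _ => P.prod P
  set S : (Fin n → Bool) → (Fin n → Z) → ℝ :=
    fun ε z => ⨆ i, (n : ℝ)⁻¹ * ∑ j, boolSign (ε j) * h i (z j) with hS
  set D : (Fin n → Z × Z) → ℝ :=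
    fun w => ⨆ i, (n : ℝ)⁻¹ * ∑ j, (h i (w j).2 - h i (w j).1) with hD
  have hSm : ∀ ε, Measurable (S ε) := fun ε => measurable_iSup_signed_mean hm ε
  have hSi : ∀ ε, Integrable (S ε) μ := fun ε => integrable_iSup_signed_mean P hn hm hB ε
  have hDm : Measurable D := Measurable.iSup fun i => by
    have := hm i
    fun_prop
  have hDB : ∀ w, |D w| ≤ B + B := fun w =>
    abs_iSup_le_of_abs_le fun i => abs_inv_mul_le_of_abs_le hn (abs_sum_le_card_mul fun j =>
      (abs_sub _ _).trans (add_le_add (hB i _) (hB i _)))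
  have hfst : MeasurePreserving (fun (w : Fin n → Z × Z) j => (w j).1) ν μ :=
    measurePreserving_pi (fun _ => P.prod P) (fun _ => P) fun _ => measurePreserving_fst
  have hsnd : MeasurePreserving (fun (w : Fin n → Z × Z) j => (w j).2) ν μ :=
    measurePreserving_pi (fun _ => P.prod P) (fun _ => P) fun _ => measurePreserving_snd
  have hle : ∀ ε, ∫ w, D w ∂ν ≤ ∫ z, S ε z ∂μ + ∫ z, S (fun j => !ε j) z ∂μ := fun ε => by
    have hswap : MeasurePreserving
        (fun (w : Fin n → Z × Z) j => if ε j then w j else (w j).swap) ν ν :=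
      measurePreserving_pi (f := fun j (p : Z × Z) => if ε j then p else p.swap)
        (fun _ => P.prod P) (fun _ => P.prod P) fun j => by
          cases ε j
          · exact Measure.measurePreserving_swap
          · exact MeasurePreserving.id (P.prod P)
    have hDmap := integral_map hswap.aemeasurable (hDm.aestronglyMeasurable (μ := ν.map _))
    have hSsnd := integral_map hsnd.aemeasurable ((hSm ε).aestronglyMeasurable (μ := ν.map _))
    have hSfst := integral_map hfst.aemeasurable
      ((hSm fun j => !ε j).aestronglyMeasurable (μ := ν.map _))
    rw [hswap.map_eq] at hDmap
    rw [hsnd.map_eq] at hSsnd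
    rw [hfst.map_eq] at hSfst
    rw [hDmap, hSsnd, hSfst]
    have hi1 := hsnd.integrable_comp_of_integrable (hSi ε)
    have hi2 := hfst.integrable_comp_of_integrable (hSi fun j => !ε j)
    refine le_trans ?_ (integral_add hi1 hi2).le
    refine integral_mono (integrable_of_abs_le (hDm.comp hswap.measurable) fun w => hDB _)
      (hi1.add hi2) fun w => ?_
    refine le_trans (le_of_eq ?_) (iSup_signed_mean_sub_le hn hB ε
      (fun j => (w j).2) (fun j => (w j).1))
    simp only [hD]
    refine iSup_congr fun i => congrArg _ (Finset.sum_congr rfl fun j _ => ?_)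
    cases ε j <;> simp
  refine (integral_deviation_le_integral_pair P hn hm hB).trans ?_
  have hsum := Finset.sum_le_sum fun (ε : Fin n → Bool) (_ : ε ∈ Finset.univ) => hle ε
  have hflip : ∑ ε : Fin n → Bool, ∫ z, S (fun j => !ε j) z ∂μ = ∑ ε, ∫ z, S ε z ∂μ :=
    (Equiv.arrowCongr (Equiv.refl (Fin n)) Equiv.boolNot).sum_comp fun ε => ∫ z, S ε z ∂μ
  have hrad : ∫ z, familyRad h z ∂μ = (2 ^ n : ℝ)⁻¹ * ∑ ε, ∫ z, S ε z ∂μ := by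
    rw [← integral_finsetSum _ fun ε _ => hSi ε, ← integral_const_mul]
    rfl
  rw [Finset.sum_add_distrib, hflip] at hsum
  simp only [Finset.sum_const, Finset.card_univ, Fintype.card_fun, Fintype.card_bool,
    Fintype.card_fin, nsmul_eq_mul, Nat.cast_pow, Nat.cast_ofNat] at hsum
  rw [hrad, mul_left_comm, le_inv_mul_iff₀ (by positivity)]
  linarith

lemma abs_iSup_sub_iSup_le {ι : Type*} [Nonempty ι] {a b : ι → ℝ} {A d : ℝ}
    (ha : ∀ i, |a i| ≤ A) (hb : ∀ i, |b i| ≤ A) (hab : ∀ i, |a i - b i| ≤ d) :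
    |(⨆ i, a i) - ⨆ i, b i| ≤ d := by
  have h1 := le_ciSup (bddAbove_range_of_abs_le ha)
  have h2 := le_ciSup (bddAbove_range_of_abs_le hb)
  rw [abs_sub_le_iff, sub_le_iff_le_add, sub_le_iff_le_add]
  exact ⟨ciSup_le fun i => by linarith [(abs_le.1 (hab i)).2, h2 i],
    ciSup_le fun i => by linarith [(abs_le.1 (hab i)).1, h1 i]⟩

/-- One-sided uniform deviation inequality for a countable family. -/
lemma measureReal_deviation_le {ι Z : Type*} [Countable ι] [Nonempty ι]
    [MeasurableSpace Z] (P : Measure Z) [IsProbabilityMeasure P] {h : ι → Z → ℝ} {B c : ℝ} {n : ℕ}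
    (hn : 1 ≤ n) (hm : ∀ i, Measurable (h i)) (hB : ∀ i z, |h i z| ≤ B) (hc0 : 0 < c)
    (hc : ∀ i x y, |h i x - h i y| ≤ c) {x : ℝ} (hx : 0 ≤ x) :
    (Measure.pi fun _ : Fin n => P).real
      {z | 2 * ∫ w : Fin n → Z, familyRad h w ∂(Measure.pi fun _ => P) + c * √x / √n ≤
        deviation P h z} ≤ Real.exp (-x) := by
  have hn0 : (0 : ℝ) < n := by exact_mod_cast hn
  have hterm := abs_deviation_term_le P hn hB
  have hdiff : ∀ (z : Fin n → Z) j y,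
      |deviation P h (Function.update z j y) - deviation P h z| ≤ (n : ℝ)⁻¹ * c := by
    intro z j y
    refine abs_iSup_sub_iSup_le (hterm _) (hterm _) fun i => ?_
    rw [_root_.sub_sub_sub_cancel_left, abs_sub_comm, ← mul_sub, ← Finset.sum_sub_distrib, abs_mul,
      abs_of_pos (inv_pos.2 hn0)]
    refine mul_le_mul_of_nonneg_left ?_ (inv_pos.2 hn0).le
    rw [Finset.sum_eq_single j (fun k _ hk => by simp [hk]) (by simp), Function.update_self]
    exact hc i _ _
  refine le_trans (measureReal_mono fun z hz => ?_)
    (measureReal_add_le_of_boundedDifferences P (mul_pos (inv_pos.2 hn0) hc0) hn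
      (measurable_deviation P n hm) (fun z => abs_iSup_le_of_abs_le (hterm z)) hdiff hx)
  refine le_trans (add_le_add (integral_deviation_le P hn hm hB) (le_of_eq ?_)) hz
  have hs : √(n : ℝ) ≠ 0 := (Real.sqrt_pos.2 hn0).ne'
  field_simp
  rw [Real.sq_sqrt hn0.le]

/-! ### Translated and composed classes -/

/-- The Rademacher average of the class of functions `ψ (f - q)`, with `f ∈ F` and `q ∈ [0, M]`. -/
lemma familyRad_comp_sub_le {Z κ : Type*} [Nonempty κ] {F : Set (Z → ℝ)} (hFne : F.Nonempty)
    {M : ℝ} (hFbd : ∀ f ∈ F, ∀ z, f z ∈ Set.Icc 0 M) {q : κ → ℝ} (hq : ∀ k, q k ∈ Set.Icc 0 M)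
    {ψ : ℝ → ℝ} {L : ℝ} (hL0 : 0 ≤ L) (hψ : ∀ x y, |ψ x - ψ y| ≤ L * |x - y|) (hψ0 : ψ 0 = 0)
    {n : ℕ} (hn : 1 ≤ n) (z : Fin n → Z) :
    familyRad (fun (p : F × κ) x => ψ ((p.1 : Z → ℝ) x - q p.2)) z ≤
      L * rad F z + L * M / √n := by
  have hn0 : (0 : ℝ) < n := by exact_mod_cast hn
  have : Nonempty F := hFne.to_subtype
  have hdiff : ∀ (p : F × κ) x, |(p.1 : Z → ℝ) x - q p.2| ≤ M := fun p x => by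
    have h1 := hFbd p.1 p.1.2 x
    have h2 := hq p.2
    exact abs_le.2 ⟨by linarith [h1.1, h2.2], by linarith [h1.2, h2.1]⟩
  have hψ' : ∀ x y, |(n : ℝ)⁻¹ * ψ x - (n : ℝ)⁻¹ * ψ y| ≤ (n : ℝ)⁻¹ * L * |x - y| := fun x y => by
    rw [← mul_sub, abs_mul, abs_of_pos (inv_pos.2 hn0), mul_assoc]
    exact mul_le_mul_of_nonneg_left (hψ x y) (inv_pos.2 hn0).le
  have hcontr := sum_iSup_contraction (n := n) (fun _ : F × κ => 0)
    (fun p j => (p.1 : Z → ℝ) (z j) - q p.2) (fun t => (n : ℝ)⁻¹ * ψ t) ((n : ℝ)⁻¹ * L) 0 M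
    ((n : ℝ)⁻¹ * L * M) hψ' (fun _ => by simp) (fun p j => hdiff p (z j)) (fun p j => by
      have h := hψ' ((p.1 : Z → ℝ) (z j) - q p.2) 0
      rw [hψ0, mul_zero, sub_zero, sub_zero] at h
      exact h.trans (mul_le_mul_of_nonneg_left (hdiff p (z j)) (by positivity)))
  simp only [zero_add] at hcontr
  have hFabs : ∀ (f : F) x, |(f : Z → ℝ) x| ≤ M := fun f x => by
    rw [abs_of_nonneg (hFbd f f.2 x).1]
    exact (hFbd f f.2 x).2
  have hterm : ∀ ε : Fin n → Bool,
      ⨆ p : F × κ, (n : ℝ)⁻¹ * L * ∑ j, boolSign (ε j) * ((p.1 : Z → ℝ) (z j) - q p.2) ≤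
        L * (⨆ f : F, (n : ℝ)⁻¹ * ∑ j, boolSign (ε j) * (f : Z → ℝ) (z j)) +
          L * M * (n : ℝ)⁻¹ * |∑ j, boolSign (ε j)| := fun ε => by
    refine ciSup_le fun p => ?_
    have h1 := le_ciSup (bddAbove_range_of_abs_le
      (abs_signed_mean_le (h := fun f : F => (f : Z → ℝ)) hn hFabs ε z)) p.1
    have h2 : -(∑ j, boolSign (ε j)) * q p.2 ≤ |∑ j, boolSign (ε j)| * M :=
      (mul_le_mul_of_nonneg_right (neg_le_abs _) (hq p.2).1).trans
        (mul_le_mul_of_nonneg_left (hq p.2).2 (abs_nonneg _))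
    have h3 := mul_le_mul_of_nonneg_left h2 (mul_nonneg hL0 (inv_pos.2 hn0).le)
    have h4 := mul_le_mul_of_nonneg_left h1 hL0
    simp only [mul_sub, Finset.sum_sub_distrib, ← Finset.sum_mul]
    linarith
  have hsum := Finset.sum_le_sum fun (ε : Fin n → Bool) (_ : ε ∈ Finset.univ) => hterm ε
  rw [Finset.sum_add_distrib, ← Finset.mul_sum, ← Finset.mul_sum] at hsum
  have hsqrt : (n : ℝ)⁻¹ * √n = 1 / √n := by rw [← div_eq_inv_mul, Real.sqrt_div_self']
  have hM : 0 ≤ M := (hq (Classical.arbitrary κ)).1.trans (hq (Classical.arbitrary κ)).2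
  have habs := mul_le_mul_of_nonneg_left (sum_abs_signed_sum_le n)
    (show 0 ≤ L * M * (n : ℝ)⁻¹ by positivity)
  have hrad : 2 ^ n * rad F z = ∑ ε : Fin n → Bool,
      ⨆ f : F, (n : ℝ)⁻¹ * ∑ j, boolSign (ε j) * (f : Z → ℝ) (z j) := by
    rw [rad, mul_inv_cancel_left₀ (by positivity)]
    rfl
  rw [← hrad] at hsum
  rw [familyRad, inv_mul_le_iff₀ (by positivity)]
  have hbound : L * M * (n : ℝ)⁻¹ * (2 ^ n * √n) = 2 ^ n * (L * M / √n) := by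
    rw [show L * M * (n : ℝ)⁻¹ * (2 ^ n * √n) = 2 ^ n * (L * M * ((n : ℝ)⁻¹ * √n)) by ring, hsqrt]
    ring
  have heq : ∀ (ε : Fin n → Bool) (p : F × κ),
      (n : ℝ)⁻¹ * ∑ j, boolSign (ε j) * ψ ((p.1 : Z → ℝ) (z j) - q p.2) =
        ∑ j, boolSign (ε j) * ((n : ℝ)⁻¹ * ψ ((p.1 : Z → ℝ) (z j) - q p.2)) := fun ε p => by
    rw [Finset.mul_sum]
    exact Finset.sum_congr rfl fun j _ => mul_left_comm _ _ _
  simp only [heq]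
  rw [mul_add, ← hbound]
  linarith

lemma continuous_of_abs_sub_le {ψ : ℝ → ℝ} {L : ℝ} (hψ : ∀ x y, |ψ x - ψ y| ≤ L * |x - y|) :
    Continuous ψ := by
  refine (LipschitzWith.of_dist_le_mul (K := L.toNNReal) fun x y => ?_).continuous
  exact (hψ x y).trans (mul_le_mul_of_nonneg_right (Real.le_coe_toNNReal L) (abs_nonneg _))

/-- One-sided uniform deviation inequality for the class of functions `ψ (f - q)`. -/
lemma measureReal_deviation_comp_sub_le {Z κ : Type*} [Countable κ] [Nonempty κ]
    [MeasurableSpace Z] (P : Measure Z) [IsProbabilityMeasure P]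
    {F : Set (Z → ℝ)} (hFc : F.Countable) (hFne : F.Nonempty) (hFmeas : ∀ f ∈ F, Measurable f)
    {M : ℝ} (hM : 0 < M) (hFbd : ∀ f ∈ F, ∀ z, f z ∈ Set.Icc 0 M)
    {q : κ → ℝ} (hq : ∀ k, q k ∈ Set.Icc 0 M)
    {ψ : ℝ → ℝ} {L : ℝ} (hL0 : 0 < L) (hψ : ∀ x y, |ψ x - ψ y| ≤ L * |x - y|) (hψ0 : ψ 0 = 0)
    {n : ℕ} (hn : 1 ≤ n) {x : ℝ} (hx : 0 ≤ x) :
    (Measure.pi fun _ : Fin n => P).real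
      {z | L * (2 * (∫ w : Fin n → Z, rad F w ∂(Measure.pi fun _ => P)) + M * (2 + √x) / √n) ≤
        deviation P (fun (p : F × κ) y => ψ ((p.1 : Z → ℝ) y - q p.2)) z} ≤ Real.exp (-x) := by
  have : Nonempty F := hFne.to_subtype
  have : Countable F := hFc.to_subtype
  set h : F × κ → Z → ℝ := fun p y => ψ ((p.1 : Z → ℝ) y - q p.2)
  have hm : ∀ p, Measurable (h p) := fun p =>
    (continuous_of_abs_sub_le hψ).measurable.comp ((hFmeas p.1 p.1.2).sub_const _)
  have hB : ∀ p y, |h p y| ≤ L * M := fun p y => by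
    have h1 := hψ ((p.1 : Z → ℝ) y - q p.2) 0
    rw [hψ0, sub_zero, sub_zero] at h1
    refine h1.trans (mul_le_mul_of_nonneg_left ?_ hL0.le)
    have h1 := hFbd p.1 p.1.2 y
    have h2 := hq p.2
    exact abs_le.2 ⟨by linarith [h1.1, h2.2], by linarith [h1.2, h2.1]⟩
  have hc : ∀ p y y', |h p y - h p y'| ≤ L * M := fun p y y' => by
    refine (hψ _ _).trans (mul_le_mul_of_nonneg_left ?_ hL0.le)
    have h1 := hFbd p.1 p.1.2 y
    have h2 := hFbd p.1 p.1.2 y'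
    exact abs_le.2 ⟨by linarith [h1.1, h2.2], by linarith [h1.2, h2.1]⟩
  have hFabs : ∀ (f : F) x, |(f : Z → ℝ) x| ≤ M := fun f x => by
    rw [abs_of_nonneg (hFbd f f.2 x).1]
    exact (hFbd f f.2 x).2
  have hradi : Integrable (fun w : Fin n → Z => rad F w) (Measure.pi fun _ => P) :=
    integrable_familyRad P (h := fun f : F => (f : Z → ℝ)) hn (fun f => hFmeas f f.2) hFabs
  have hrad : ∫ w : Fin n → Z, familyRad h w ∂(Measure.pi fun _ => P) ≤
      L * (∫ w : Fin n → Z, rad F w ∂(Measure.pi fun _ => P)) + L * M / √n := by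
    refine (integral_mono (integrable_familyRad P hn hm hB)
      ((hradi.const_mul L).add (integrable_const (L * M / √n)))
      (familyRad_comp_sub_le hFne hFbd hq hL0.le hψ hψ0 hn)).trans_eq ?_
    simp only [Pi.add_apply]
    rw [integral_add (hradi.const_mul L) (integrable_const _), integral_const_mul]
    simp
  refine le_trans (measureReal_mono fun z hz => ?_)
    (measureReal_deviation_le P hn hm hB (mul_pos hL0 hM) hc hx)
  rw [Set.mem_ofPred_eq] at hz ⊢
  refine le_trans ?_ hz
  have : L * M * √x / √n + 2 * (L * M / √n) = L * (M * (2 + √x) / √n) := by ring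
  rw [mul_add]
  linarith

/-! ### Optimized certainty equivalents -/

/-- Moving `lam` to the nearest point of `[0, M]` does not increase the objective. -/
lemma clamp_add_le {φ : ℝ → ℝ} (hφ : IsDisutility φ) {M y : ℝ} (hM : 0 ≤ M)
    (hy : y ∈ Set.Icc 0 M) (lam : ℝ) :
    max 0 (min M lam) + φ (y - max 0 (min M lam)) ≤ lam + φ (y - lam) := by
  obtain ⟨-, hconv, h0, hle⟩ := hφ
  have hg : ConvexOn ℝ Set.univ fun t => φ t - t := hconv.sub (concaveOn_id convex_univ)
  have key : y - max 0 (min M lam) ∈ segment ℝ 0 (y - lam) := by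
    rw [segment_eq_uIcc, Set.mem_uIcc]
    have := hy.1
    have := hy.2
    rcases le_total lam 0 with h | h
    · left
      rw [min_eq_right (h.trans hM), max_eq_left h]
      constructor <;> linarith
    · rcases le_total lam M with h' | h'
      · rw [min_eq_right h', max_eq_right h]
        rcases le_total lam y with h'' | h''
        · left; constructor <;> linarith
        · right; constructor <;> linarith
      · right
        rw [min_eq_left h', max_eq_right hM]
        constructor <;> linarith
  have h := hg.le_on_segment (Set.mem_univ _) (Set.mem_univ _) key
  simp only [h0, sub_zero] at h
  rw [max_eq_right (a := (0 : ℝ)) (b := φ (y - lam) - (y - lam))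
    (by linarith [hle (y - lam)])] at h
  linarith

lemma OCE_le_OCE_add {Z : Type*} [MeasurableSpace Z] {Q Q' : Measure Z} [IsProbabilityMeasure Q]
    [IsProbabilityMeasure Q'] {φ : ℝ → ℝ} (hφ : IsDisutility φ) (hφc : Continuous φ) {f : Z → ℝ}
    (hf : Measurable f) {M b : ℝ} (hM : 0 ≤ M) (hfM : ∀ z, f z ∈ Set.Icc 0 M)
    (h : ∀ lam ∈ Set.Icc 0 M, ∫ z, φ (f z - lam) ∂Q ≤ ∫ z, φ (f z - lam) ∂Q' + b) :
    OCE φ f Q ≤ OCE φ f Q' + b := by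
  have hint : ∀ (R : Measure Z) [IsProbabilityMeasure R] (lam : ℝ),
      Integrable (fun z => φ (f z - lam)) R := fun R _ lam => by
    refine Integrable.of_mem_Icc (φ (-lam)) (φ (M - lam))
      (hφc.measurable.comp (hf.sub_const lam)).aemeasurable
      (Filter.Eventually.of_forall fun z => ⟨hφ.1 ?_, hφ.1 ?_⟩)
    · linarith [(hfM z).1]
    · linarith [(hfM z).2]
  have hfint : Integrable f Q := Integrable.of_mem_Icc 0 M hf.aemeasurable
    (Filter.Eventually.of_forall hfM)
  have hbdd : BddBelow (range fun lam : ℝ => lam + ∫ z, φ (f z - lam) ∂Q) := by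
    refine ⟨0, ?_⟩
    rintro _ ⟨lam, rfl⟩
    have h1 : ∫ z, (f z - lam) ∂Q ≤ ∫ z, φ (f z - lam) ∂Q :=
      integral_mono (hfint.sub (integrable_const _)) (hint Q lam) fun z => hφ.2.2.2 _
    have h2 : 0 ≤ ∫ z, f z ∂Q := integral_nonneg fun z => (hfM z).1
    rw [integral_sub hfint (integrable_const _)] at h1
    simp only [integral_const, probReal_univ, smul_eq_mul, one_mul] at h1
    simp only
    linarith
  rw [← sub_le_iff_le_add]
  refine le_ciInf fun lam => ?_
  set c := max 0 (min M lam)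
  have hc : c ∈ Set.Icc 0 M := ⟨le_max_left _ _, max_le hM (min_le_left _ _)⟩
  have h1 : OCE φ f Q ≤ c + ∫ z, φ (f z - c) ∂Q := ciInf_le hbdd c
  have h2 : ∫ z, (c + φ (f z - c)) ∂Q' ≤ ∫ z, (lam + φ (f z - lam)) ∂Q' :=
    integral_mono ((integrable_const _).add (hint Q' c)) ((integrable_const _).add (hint Q' lam))
      fun z => clamp_add_le hφ hM (hfM z) lam
  rw [integral_add (integrable_const _) (hint Q' c),
    integral_add (integrable_const _) (hint Q' lam)] at h2
  simp only [integral_const, probReal_univ, smul_eq_mul, one_mul] at h2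
  linarith [h c hc]

lemma isProbabilityMeasure_empMeas {Z : Type*} [MeasurableSpace Z] {n : ℕ} (hn : 1 ≤ n)
    (z : Fin n → Z) : IsProbabilityMeasure (empMeas z) := by
  refine ⟨?_⟩
  simp only [empMeas, Measure.smul_apply, Measure.finsetSum_apply, measure_univ, Finset.sum_const,
    Finset.card_univ, Fintype.card_fin, nsmul_eq_mul, mul_one, smul_eq_mul]
  exact ENNReal.inv_mul_cancel (by exact_mod_cast (by omega : n ≠ 0)) (ENNReal.natCast_ne_top n)

lemma integral_empMeas {Z : Type*} [MeasurableSpace Z] {n : ℕ} (z : Fin n → Z) {g : Z → ℝ}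
    (hg : Measurable g) : ∫ x, g x ∂(empMeas z) = (n : ℝ)⁻¹ * ∑ j, g (z j) := by
  rw [empMeas, integral_smul_measure, integral_finsetSum_measure]
  · simp [integral_dirac' _ _ hg.stronglyMeasurable]
  · exact fun j _ => (integrable_dirac' hg.stronglyMeasurable (by simp))

lemma continuous_integral_comp_sub {Z : Type*} [MeasurableSpace Z] (Q : Measure Z)
    [IsProbabilityMeasure Q] {φ : ℝ → ℝ} (hφm : Monotone φ) (hφc : Continuous φ) {f : Z → ℝ}
    (hf : Measurable f) {M : ℝ} (hfM : ∀ z, f z ∈ Set.Icc 0 M) :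
    Continuous fun lam : Set.Icc (0 : ℝ) M => ∫ z, φ (f z - lam) ∂Q := by
  refine continuous_of_dominated (bound := fun _ => max |φ (-M)| |φ M|)
    (fun lam => (hφc.measurable.comp (hf.sub_const _)).aestronglyMeasurable)
    (fun lam => Filter.Eventually.of_forall fun z => ?_) (integrable_const _)
    (Filter.Eventually.of_forall fun z => by fun_prop)
  refine abs_le_max_abs_abs (hφm ?_) (hφm ?_)
  · linarith [(hfM z).1, lam.2.2]
  · linarith [(hfM z).2, lam.2.1]

/-- Control of the objectives at a dense set of points controls the certainty equivalents. -/
lemma abs_OCE_sub_OCE_le_of_dense {Z κ : Type*} [MeasurableSpace Z] {Q Q' : Measure Z}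
    [IsProbabilityMeasure Q] [IsProbabilityMeasure Q'] {φ : ℝ → ℝ} (hφ : IsDisutility φ)
    (hφc : Continuous φ) {f : Z → ℝ} (hf : Measurable f) {M b : ℝ} (hM : 0 ≤ M)
    (hfM : ∀ z, f z ∈ Set.Icc 0 M) {q : κ → Set.Icc (0 : ℝ) M} (hq : DenseRange q)
    (h : ∀ k, |∫ z, φ (f z - q k) ∂Q - ∫ z, φ (f z - q k) ∂Q'| ≤ b) :
    |OCE φ f Q - OCE φ f Q'| ≤ b := by
  have hall : ∀ lam : Set.Icc (0 : ℝ) M,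
      |∫ z, φ (f z - lam) ∂Q - ∫ z, φ (f z - lam) ∂Q'| ≤ b := fun lam =>
    hq.induction_on lam (isClosed_le ((continuous_integral_comp_sub Q hφ.1 hφc hf hfM).sub
      (continuous_integral_comp_sub Q' hφ.1 hφc hf hfM)).abs continuous_const) h
  have h1 : OCE φ f Q ≤ OCE φ f Q' + b := OCE_le_OCE_add hφ hφc hf hM hfM fun lam hlam => by
    linarith [(abs_le.1 (hall ⟨lam, hlam⟩)).2]
  have h2 : OCE φ f Q' ≤ OCE φ f Q + b := OCE_le_OCE_add hφ hφc hf hM hfM fun lam hlam => by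
    linarith [(abs_le.1 (hall ⟨lam, hlam⟩)).1]
  exact abs_le.2 ⟨by linarith, by linarith⟩

/-- uniform convergence of the empirical OCE risk to the population OCE risk,
in terms of the expected Rademacher average of the hypothesis class. -/
theorem oce_uniform_convergence {Z : Type*} [MeasurableSpace Z]
    (P : Measure Z) [IsProbabilityMeasure P] (M : ℝ) (hM : 0 < M)
    (F : Set (Z → ℝ)) (hFc : F.Countable) (hFne : F.Nonempty)
    (hFmeas : ∀ f ∈ F, Measurable f) (hFbd : ∀ f ∈ F, ∀ z, f z ∈ Set.Icc 0 M)
    (φ : ℝ → ℝ) (hφ : IsDisutility φ)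
    (L : ℝ) (hL : ∀ x y : ℝ, |φ x - φ y| ≤ L * |x - y|)
    (n : ℕ) (hn : 1 ≤ n) (δ : ℝ) (hδ : δ ∈ Set.Ioc (0 : ℝ) 1) :
    ENNReal.ofReal (1 - δ) ≤
      (Measure.pi fun _ : Fin n => P)
        {z : Fin n → Z |
          (⨆ f : F, |OCE φ (f : Z → ℝ) P - OCE φ (f : Z → ℝ) (empMeas z)|) ≤
            L * (2 * (∫ w, rad F w ∂(Measure.pi fun _ : Fin n => P)) +
              M * (2 + Real.sqrt (Real.log (2 / δ))) / Real.sqrt n)} := by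

  obtain ⟨hδ0, hδ1⟩ := hδ
  have hφc : Continuous φ := continuous_of_abs_sub_le hL
  have hL0 : 0 < L := by
    have h1 := hL 1 0
    rw [hφ.2.2.1, sub_zero, sub_zero, abs_one, mul_one] at h1
    linarith [hφ.2.2.2 1, le_abs_self (φ 1)]
  have : Nonempty F := hFne.to_subtype
  have : Nonempty (Set.Icc (0 : ℝ) M) := ⟨⟨0, le_rfl, hM.le⟩⟩
  set q : ℕ → Set.Icc (0 : ℝ) M := TopologicalSpace.denseSeq (Set.Icc (0 : ℝ) M)
  have hq : DenseRange q := TopologicalSpace.denseRange_denseSeq _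
  set μ : Measure (Fin n → Z) := Measure.pi fun _ => P
  set x := Real.log (2 / δ) with hx
  have h2δ : 1 ≤ 2 / δ := by rw [le_div_iff₀ hδ0]; linarith
  have hx0 : 0 ≤ x := Real.log_nonneg h2δ
  have hexp : Real.exp (-x) = δ / 2 := by
    rw [Real.exp_neg, hx, Real.exp_log (by positivity), inv_div]
  set b := L * (2 * (∫ w, rad F w ∂μ) + M * (2 + √x) / √n) with hb
  set up : F × ℕ → Z → ℝ := fun p y => φ ((p.1 : Z → ℝ) y - q p.2) with hup
  set dn : F × ℕ → Z → ℝ := fun p y => -φ ((p.1 : Z → ℝ) y - q p.2) with hdn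
  have hupm : ∀ p, Measurable (up p) := fun p =>
    hφc.measurable.comp ((hFmeas p.1 p.1.2).sub_const _)
  have hupB : ∀ p y, |up p y| ≤ max |φ (-M)| |φ M| := fun p y => by
    have h1 := hFbd p.1 p.1.2 y
    have h2 := (q p.2).2
    exact abs_le_max_abs_abs (hφ.1 (by linarith [h1.1, h2.2])) (hφ.1 (by linarith [h1.2, h2.1]))
  have htail_up : μ.real {z | b ≤ deviation P up z} ≤ δ / 2 :=
    (measureReal_deviation_comp_sub_le P hFc hFne hFmeas hM hFbd (fun k => (q k).2) hL0 hL
      hφ.2.2.1 hn hx0).trans_eq hexp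
  have htail_dn : μ.real {z | b ≤ deviation P dn z} ≤ δ / 2 :=
    (measureReal_deviation_comp_sub_le P hFc hFne hFmeas hM hFbd (fun k => (q k).2) hL0
      (ψ := fun t => -φ t) (fun s t => by rw [neg_sub_neg, abs_sub_comm]; exact hL s t)
      (by simp [hφ.2.2.1]) hn hx0).trans_eq hexp
  set S : Set (Fin n → Z) := {z | (⨆ f : F, |OCE φ (f : Z → ℝ) P - OCE φ (f : Z → ℝ) (empMeas z)|)
    ≤ b} with hS
  have hcover : (Set.univ : Set (Fin n → Z)) ⊆
      S ∪ ({z | b ≤ deviation P up z} ∪ {z | b ≤ deviation P dn z}) := fun z _ => by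
    by_cases h1 : b ≤ deviation P up z
    · exact Or.inr (Or.inl h1)
    by_cases h2 : b ≤ deviation P dn z
    · exact Or.inr (Or.inr h2)
    left
    rw [hS, Set.mem_ofPred_eq]
    refine ciSup_le fun f => ?_
    have := isProbabilityMeasure_empMeas hn z
    refine abs_OCE_sub_OCE_le_of_dense hφ hφc (hFmeas f f.2) hM.le (hFbd f f.2) hq fun k => ?_
    have hu := le_ciSup (bddAbove_range_of_abs_le (abs_deviation_term_le P hn hupB z)) (f, k)
    have hd := le_ciSup (bddAbove_range_of_abs_le (abs_deviation_term_le P hn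
      (h := dn) (fun p y => (abs_neg (up p y)).trans_le (hupB p y)) z)) (f, k)
    rw [integral_empMeas z (hupm (f, k))]
    replace hu := hu.trans (not_le.1 h1).le
    replace hd := hd.trans (not_le.1 h2).le
    simp only [hup] at hu
    simp only [hdn, integral_neg, Finset.sum_neg_distrib] at hd
    exact abs_le.2 ⟨by linarith, by linarith⟩
  have htotal := (measureReal_mono (μ := μ) hcover).trans
    ((measureReal_union_le _ _).trans (add_le_add_right (measureReal_union_le _ _) _))
  rw [probReal_univ] at htotal
  refine ENNReal.ofReal_le_of_le_toReal ?_
  change 1 - δ ≤ μ.real S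
  linarith
end
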